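/- arXiv:2211.15885 — 2 statements merged into one kernel-verified Lean document; each statement's English description precedes it below -/
import Mathlib

section
/- Let A, B, C be k-algebras and let τ_AB : B ⊗ A → A ⊗ B, τ_BC : C ⊗ B → B ⊗ C, τ_AC : C ⊗ A → A ⊗ C be twisting maps. Define τ₁ := (1_A ⊗ τ_BC) ∘ (τ_AC ⊗ 1_B) : C ⊗ (A ⊗ B) → (A ⊗ B) ⊗ C and τ₂ := (τ_AB ⊗ 1_C) ∘ (1_B ⊗ τ_AC) : (B ⊗ C) ⊗ A → A ⊗ (B ⊗ C). Then τ₁ is a twisting map between the algebras A ⊗_{τ_AB} B and C if and only if τ₂ is a twisting map between the algebras A and B ⊗_{τ_BC} C; and in that case the canonical associator (a ⊗ b) ⊗ c ↦ a ⊗ (b ⊗ c) is an isomorphism of algebras (A ⊗_{τ_AB} B) ⊗_{τ₁} C ≅ A ⊗_{τ₂} (B ⊗_{τ_BC} C). -/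
open TensorProduct

section TTPDefs

variable (k : Type*) [Field k]
variable {A B : Type*} [AddCommGroup A] [Module k A] [AddCommGroup B] [Module k B]

/-- The rearrangement `1 ⊗ τ ⊗ 1 : (A ⊗ B) ⊗ (A ⊗ B) → (A ⊗ A) ⊗ (B ⊗ B)`. -/
noncomputable def middleTwist (τ : B ⊗[k] A →ₗ[k] A ⊗[k] B) :
    (A ⊗[k] B) ⊗[k] (A ⊗[k] B) →ₗ[k] (A ⊗[k] A) ⊗[k] (B ⊗[k] B) :=
  (TensorProduct.assoc k A A (B ⊗[k] B)).symm.toLinearMap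
    ∘ₗ TensorProduct.map (LinearMap.id : A →ₗ[k] A) (TensorProduct.assoc k A B B).toLinearMap
    ∘ₗ TensorProduct.map (LinearMap.id : A →ₗ[k] A)
        (TensorProduct.map τ (LinearMap.id : B →ₗ[k] B))
    ∘ₗ TensorProduct.map (LinearMap.id : A →ₗ[k] A)
        (TensorProduct.assoc k B A B).symm.toLinearMap
    ∘ₗ (TensorProduct.assoc k A B (A ⊗[k] B)).toLinearMap

/-- The twisted tensor product multiplication `∇_τ = (mA ⊗ mB) ∘ (1 ⊗ τ ⊗ 1)` on `A ⊗ B`,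
for given multiplication maps `mA`, `mB`. -/
noncomputable def ttpMul (mA : A ⊗[k] A →ₗ[k] A) (mB : B ⊗[k] B →ₗ[k] B)
    (τ : B ⊗[k] A →ₗ[k] A ⊗[k] B) :
    (A ⊗[k] B) ⊗[k] (A ⊗[k] B) →ₗ[k] A ⊗[k] B :=
  TensorProduct.map mA mB ∘ₗ middleTwist k τ

/-- The rearrangement `1 ⊗ τ ⊗ 1 : (B ⊗ B) ⊗ (A ⊗ A) → (B ⊗ A) ⊗ (B ⊗ A)`. -/
noncomputable def preTwist (τ : B ⊗[k] A →ₗ[k] A ⊗[k] B) :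
    (B ⊗[k] B) ⊗[k] (A ⊗[k] A) →ₗ[k] (B ⊗[k] A) ⊗[k] (B ⊗[k] A) :=
  (TensorProduct.assoc k B A (B ⊗[k] A)).symm.toLinearMap
    ∘ₗ TensorProduct.map (LinearMap.id : B →ₗ[k] B) (TensorProduct.assoc k A B A).toLinearMap
    ∘ₗ TensorProduct.map (LinearMap.id : B →ₗ[k] B)
        (TensorProduct.map τ (LinearMap.id : A →ₗ[k] A))
    ∘ₗ TensorProduct.map (LinearMap.id : B →ₗ[k] B)
        (TensorProduct.assoc k B A A).symm.toLinearMap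
    ∘ₗ (TensorProduct.assoc k B B (A ⊗[k] A)).toLinearMap

/-- `τ : B ⊗ A → A ⊗ B` is a twisting map with respect to the given units `uA`, `uB` and
multiplication maps `mA`, `mB`: it is bijective, compatible with the units, and
`τ ∘ (mB ⊗ mA) = (mA ⊗ mB) ∘ (1 ⊗ τ ⊗ 1) ∘ (τ ⊗ τ) ∘ (1 ⊗ τ ⊗ 1)`. -/
def IsTwistingMapGen (uA : A) (mA : A ⊗[k] A →ₗ[k] A) (uB : B) (mB : B ⊗[k] B →ₗ[k] B)
    (τ : B ⊗[k] A →ₗ[k] A ⊗[k] B) : Prop :=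
  Function.Bijective τ ∧
  (∀ b : B, τ (b ⊗ₜ[k] uA) = uA ⊗ₜ[k] b) ∧
  (∀ a : A, τ (uB ⊗ₜ[k] a) = a ⊗ₜ[k] uB) ∧
  τ ∘ₗ TensorProduct.map mB mA
    = ttpMul k mA mB τ ∘ₗ TensorProduct.map τ τ ∘ₗ preTwist k τ

end TTPDefs

/-- A twisting map between two `k`-algebras `A` and `B`. -/
def IsTwistingMap (k : Type*) [Field k] {A B : Type*}
    [Ring A] [Algebra k A] [Ring B] [Algebra k B]
    (τ : B ⊗[k] A →ₗ[k] A ⊗[k] B) : Prop :=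
  IsTwistingMapGen k (1 : A) (LinearMap.mul' k A) (1 : B) (LinearMap.mul' k B) τ

/-!
Statement 8: Compatibility of three twisting maps and associativity of iterated
twisted tensor products:
`τ₁ = (1_A ⊗ τ_BC) ∘ (τ_AC ⊗ 1_B)` is a twisting map between `A ⊗_{τ_AB} B` and `C`
iff `τ₂ = (τ_AB ⊗ 1_C) ∘ (1_B ⊗ τ_AC)` is a twisting map between `A` and `B ⊗_{τ_BC} C`,
and in that case the canonical associator is an algebra isomorphism
`(A ⊗_{τ_AB} B) ⊗_{τ₁} C ≅ A ⊗_{τ₂} (B ⊗_{τ_BC} C)`.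
-/

/-- `τ₁ = (1_A ⊗ τ_BC) ∘ (τ_AC ⊗ 1_B) : C ⊗ (A ⊗ B) → (A ⊗ B) ⊗ C`. -/
noncomputable def tauOne {k A B C : Type*} [Field k]
    [AddCommGroup A] [Module k A] [AddCommGroup B] [Module k B] [AddCommGroup C] [Module k C]
    (τBC : C ⊗[k] B →ₗ[k] B ⊗[k] C) (τAC : C ⊗[k] A →ₗ[k] A ⊗[k] C) :
    C ⊗[k] (A ⊗[k] B) →ₗ[k] (A ⊗[k] B) ⊗[k] C :=
  (TensorProduct.assoc k A B C).symm.toLinearMap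
    ∘ₗ TensorProduct.map (LinearMap.id : A →ₗ[k] A) τBC
    ∘ₗ (TensorProduct.assoc k A C B).toLinearMap
    ∘ₗ TensorProduct.map τAC (LinearMap.id : B →ₗ[k] B)
    ∘ₗ (TensorProduct.assoc k C A B).symm.toLinearMap

/-- `τ₂ = (τ_AB ⊗ 1_C) ∘ (1_B ⊗ τ_AC) : (B ⊗ C) ⊗ A → A ⊗ (B ⊗ C)`. -/
noncomputable def tauTwo {k A B C : Type*} [Field k]
    [AddCommGroup A] [Module k A] [AddCommGroup B] [Module k B] [AddCommGroup C] [Module k C]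
    (τAB : B ⊗[k] A →ₗ[k] A ⊗[k] B) (τAC : C ⊗[k] A →ₗ[k] A ⊗[k] C) :
    (B ⊗[k] C) ⊗[k] A →ₗ[k] A ⊗[k] (B ⊗[k] C) :=
  (TensorProduct.assoc k A B C).toLinearMap
    ∘ₗ TensorProduct.map τAB (LinearMap.id : C →ₗ[k] C)
    ∘ₗ (TensorProduct.assoc k B A C).symm.toLinearMap
    ∘ₗ TensorProduct.map (LinearMap.id : B →ₗ[k] B) τAC
    ∘ₗ (TensorProduct.assoc k B C A).toLinearMap

section TwistingMaps

variable {k A B : Type*} [Field k] [AddCommGroup A] [Module k A] [AddCommGroup B] [Module k B]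

/-- Compatibility of `τ` with the multiplication of `B`:
`τ ∘ (mB ⊗ 1) = (1 ⊗ mB) ∘ (τ ⊗ 1) ∘ (1 ⊗ τ)`. -/
def IsLeftTwisting (mB : B ⊗[k] B →ₗ[k] B) (τ : B ⊗[k] A →ₗ[k] A ⊗[k] B) : Prop :=
  ∀ (b b' : B) (a : A), τ (mB (b ⊗ₜ b') ⊗ₜ a) =
    mB.lTensor A (TensorProduct.assoc k A B B
      (τ.rTensor B ((TensorProduct.assoc k B A B).symm (b ⊗ₜ τ (b' ⊗ₜ a)))))

/-- Compatibility of `τ` with the multiplication of `A`: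
`τ ∘ (1 ⊗ mA) = (mA ⊗ 1) ∘ (1 ⊗ τ) ∘ (τ ⊗ 1)`. -/
def IsRightTwisting (mA : A ⊗[k] A →ₗ[k] A) (τ : B ⊗[k] A →ₗ[k] A ⊗[k] B) : Prop :=
  ∀ (b : B) (a a' : A), τ (b ⊗ₜ mA (a ⊗ₜ a')) =
    mA.rTensor B ((TensorProduct.assoc k A A B).symm
      (τ.lTensor A (TensorProduct.assoc k A B A (τ (b ⊗ₜ a) ⊗ₜ a'))))

variable {uA : A} {uB : B} {mA : A ⊗[k] A →ₗ[k] A} {mB : B ⊗[k] B →ₗ[k] B}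
  {τ : B ⊗[k] A →ₗ[k] A ⊗[k] B}

lemma IsTwistingMapGen.isLeftTwisting (h : IsTwistingMapGen k uA mA uB mB τ)
    (hA : ∀ a, mA (a ⊗ₜ uA) = a) : IsLeftTwisting mB τ := by
  obtain ⟨-, h1, -, h⟩ := h
  intro b b' a
  have := LinearMap.congr_fun h ((b ⊗ₜ b') ⊗ₜ (a ⊗ₜ uA))
  simp only [LinearMap.comp_apply, TensorProduct.map_tmul, hA] at this
  rw [this]
  simp only [preTwist, LinearMap.comp_apply, LinearEquiv.coe_coe, TensorProduct.assoc_tmul,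
    TensorProduct.map_tmul, LinearMap.id_apply, TensorProduct.assoc_symm_tmul]
  generalize τ (b' ⊗ₜ a) = x
  induction x with
  | zero => simp
  | add x y hx hy => simp only [map_add, TensorProduct.tmul_add, TensorProduct.add_tmul, hx, hy]
  | tmul a₁ b₁ =>
    simp only [TensorProduct.assoc_tmul, TensorProduct.map_tmul, TensorProduct.assoc_symm_tmul, h1,
      LinearMap.rTensor_tmul]
    generalize τ (b ⊗ₜ a₁) = x
    induction x with
    | zero => simp
    | add x y hx hy => simp only [map_add, TensorProduct.add_tmul, hx, hy]
    | tmul a₂ b₂ => simp [ttpMul, middleTwist, h1, hA]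

lemma IsTwistingMapGen.isRightTwisting (h : IsTwistingMapGen k uA mA uB mB τ)
    (hB : ∀ b, mB (uB ⊗ₜ b) = b) : IsRightTwisting mA τ := by
  obtain ⟨-, -, h1, h⟩ := h
  intro b a a'
  have := LinearMap.congr_fun h ((uB ⊗ₜ b) ⊗ₜ (a ⊗ₜ a'))
  simp only [LinearMap.comp_apply, TensorProduct.map_tmul, hB] at this
  rw [this]
  simp only [preTwist, LinearMap.comp_apply, LinearEquiv.coe_coe, TensorProduct.assoc_tmul,
    TensorProduct.map_tmul, LinearMap.id_apply, TensorProduct.assoc_symm_tmul]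
  generalize τ (b ⊗ₜ a) = x
  induction x with
  | zero => simp
  | add x y hx hy => simp only [map_add, TensorProduct.tmul_add, TensorProduct.add_tmul, hx, hy]
  | tmul a₁ b₁ =>
    simp only [TensorProduct.assoc_tmul, TensorProduct.map_tmul, TensorProduct.assoc_symm_tmul, h1,
      LinearMap.lTensor_tmul]
    generalize τ (b₁ ⊗ₜ a') = x
    induction x with
    | zero => simp
    | add x y hx hy => simp only [map_add, TensorProduct.tmul_add, hx, hy]
    | tmul a₂ b₂ => simp [ttpMul, middleTwist, h1, hB]

lemma IsLeftTwisting.comp_map_eq (hL : IsLeftTwisting mB τ) (hR : IsRightTwisting mA τ) :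
    τ ∘ₗ TensorProduct.map mB mA = ttpMul k mA mB τ ∘ₗ TensorProduct.map τ τ ∘ₗ preTwist k τ := by
  refine TensorProduct.ext_fourfold' fun b b' a a' => ?_
  simp only [LinearMap.comp_apply, TensorProduct.map_tmul, preTwist, LinearEquiv.coe_coe,
    TensorProduct.assoc_tmul, LinearMap.id_apply, TensorProduct.assoc_symm_tmul]
  rw [hL, hR]
  generalize τ (b' ⊗ₜ a) = x
  induction x with
  | zero => simp
  | add x y hx hy => simp only [map_add, TensorProduct.tmul_add, TensorProduct.add_tmul, hx, hy]
  | tmul a₁ b₁ =>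
    simp only [TensorProduct.assoc_tmul, TensorProduct.map_tmul, TensorProduct.assoc_symm_tmul,
      LinearMap.lTensor_tmul]
    generalize τ (b₁ ⊗ₜ a') = x
    induction x with
    | zero => simp
    | add x y hx hy => simp only [map_add, TensorProduct.tmul_add, hx, hy]
    | tmul a₂ b₂ =>
      simp only [TensorProduct.assoc_symm_tmul, LinearMap.rTensor_tmul]
      rw [hR]
      generalize τ (b ⊗ₜ a₁) = x
      induction x with
      | zero => simp
      | add x y hx hy => simp only [map_add, TensorProduct.add_tmul, hx, hy]
      | tmul a₃ b₃ =>
        simp only [ttpMul, middleTwist, LinearMap.comp_apply, TensorProduct.map_tmul,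
          LinearEquiv.coe_coe, TensorProduct.assoc_tmul, LinearMap.id_apply,
          TensorProduct.assoc_symm_tmul, LinearMap.lTensor_tmul]
        generalize τ (b₃ ⊗ₜ a₂) = x
        induction x with
        | zero => simp
        | add x y hx hy =>
          simp only [map_add, TensorProduct.tmul_add, TensorProduct.add_tmul, hx, hy]
        | tmul a₄ b₄ => simp

end TwistingMaps

section ThreeTwists

variable {k A B C : Type*} [Field k] [AddCommGroup A] [Module k A] [AddCommGroup B] [Module k B]
  [AddCommGroup C] [Module k C]
  {mA : A ⊗[k] A →ₗ[k] A} {mB : B ⊗[k] B →ₗ[k] B} {mC : C ⊗[k] C →ₗ[k] C}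
  {τAB : B ⊗[k] A →ₗ[k] A ⊗[k] B} {τBC : C ⊗[k] B →ₗ[k] B ⊗[k] C} {τAC : C ⊗[k] A →ₗ[k] A ⊗[k] C}

lemma ttpMul_tmul (τ : B ⊗[k] A →ₗ[k] A ⊗[k] B) (a a' : A) (b b' : B) :
    ttpMul k mA mB τ ((a ⊗ₜ b) ⊗ₜ (a' ⊗ₜ b')) =
      TensorProduct.map mA mB ((TensorProduct.assoc k A A (B ⊗[k] B)).symm
        (a ⊗ₜ TensorProduct.assoc k A B B (τ (b ⊗ₜ a') ⊗ₜ b'))) := by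
  simp [ttpMul, middleTwist]

lemma tauOne_tmul (c : C) (a : A) (b : B) :
    tauOne τBC τAC (c ⊗ₜ (a ⊗ₜ b)) = (TensorProduct.assoc k A B C).symm
      (τBC.lTensor A (TensorProduct.assoc k A C B (τAC (c ⊗ₜ a) ⊗ₜ b))) := by
  simp [tauOne, LinearMap.lTensor]

lemma tauTwo_tmul (b : B) (c : C) (a : A) :
    tauTwo τAB τAC ((b ⊗ₜ c) ⊗ₜ a) = TensorProduct.assoc k A B C
      (τAB.rTensor C ((TensorProduct.assoc k B A C).symm (b ⊗ₜ τAC (c ⊗ₜ a)))) := by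
  simp [tauTwo, LinearMap.rTensor]

lemma tauOne_bijective (hBC : Function.Bijective τBC) (hAC : Function.Bijective τAC) :
    Function.Bijective (tauOne τBC τAC) :=
  (((((TensorProduct.assoc k C A B).symm ≪≫ₗ
    TensorProduct.congr (.ofBijective τAC hAC) (.refl k B)) ≪≫ₗ TensorProduct.assoc k A C B) ≪≫ₗ
    TensorProduct.congr (.refl k A) (.ofBijective τBC hBC)) ≪≫ₗ
    (TensorProduct.assoc k A B C).symm).bijective

lemma tauTwo_bijective (hAB : Function.Bijective τAB) (hAC : Function.Bijective τAC) :
    Function.Bijective (tauTwo τAB τAC) :=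
  ((((TensorProduct.assoc k B C A ≪≫ₗ
    TensorProduct.congr (.refl k B) (.ofBijective τAC hAC)) ≪≫ₗ
    (TensorProduct.assoc k B A C).symm) ≪≫ₗ
    TensorProduct.congr (.ofBijective τAB hAB) (.refl k C)) ≪≫ₗ
    TensorProduct.assoc k A B C).bijective

lemma IsLeftTwisting.tauOne (hBC : IsLeftTwisting mC τBC) (hAC : IsLeftTwisting mC τAC) :
    IsLeftTwisting mC (tauOne τBC τAC) := by
  intro c c' x
  induction x with
  | zero => simp
  | add x y hx hy => simp only [map_add, TensorProduct.tmul_add, hx, hy]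
  | tmul a b =>
    rw [tauOne_tmul, tauOne_tmul, hAC]
    generalize τAC (c' ⊗ₜ a) = x
    induction x with
    | zero => simp
    | add x y hx hy => simp only [map_add, TensorProduct.tmul_add, TensorProduct.add_tmul, hx, hy]
    | tmul a₁ c₁ =>
      simp only [TensorProduct.assoc_tmul, TensorProduct.assoc_symm_tmul, LinearMap.lTensor_tmul,
        LinearMap.rTensor_tmul]
      have key (x : A ⊗[k] C) : (TensorProduct.assoc k A B C).symm (τBC.lTensor A
          (TensorProduct.assoc k A C B (mC.lTensor A (TensorProduct.assoc k A C C (x ⊗ₜ c₁)) ⊗ₜ b)))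
          = (TensorProduct.assoc k A B C).symm (((mC.lTensor B).lTensor A)
            (((TensorProduct.assoc k B C C).toLinearMap.lTensor A)
            (((τBC.rTensor C).lTensor A)
            (((TensorProduct.assoc k C B C).symm.toLinearMap.lTensor A)
            (TensorProduct.assoc k A C (B ⊗[k] C) (x ⊗ₜ τBC (c₁ ⊗ₜ b))))))) := by
        induction x with
        | zero => simp
        | add x y hx hy => simp only [map_add, TensorProduct.add_tmul, hx, hy]
        | tmul a₂ c₂ => simp [hBC c₂ c₁ b]
      rw [key]
      generalize τBC (c₁ ⊗ₜ b) = y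
      induction y with
      | zero => simp
      | add x y hx hy => simp only [map_add, TensorProduct.tmul_add, hx, hy]
      | tmul b₁ c₂ =>
        simp only [TensorProduct.assoc_symm_tmul, LinearMap.rTensor_tmul, tauOne_tmul]
        generalize τAC (c ⊗ₜ a₁) = x
        induction x with
        | zero => simp
        | add x y hx hy => simp only [map_add, TensorProduct.add_tmul, hx, hy]
        | tmul a₂ c₃ =>
          simp only [TensorProduct.assoc_tmul, TensorProduct.assoc_symm_tmul,
            LinearMap.lTensor_tmul, LinearMap.rTensor_tmul, LinearEquiv.coe_coe]
          generalize τBC (c₃ ⊗ₜ b₁) = y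
          induction y with
          | zero => simp
          | add x y hx hy =>
            simp only [map_add, TensorProduct.tmul_add, TensorProduct.add_tmul, hx, hy]
          | tmul b₂ c₄ => simp

lemma IsRightTwisting.tauTwo (hAB : IsRightTwisting mA τAB) (hAC : IsRightTwisting mA τAC) :
    IsRightTwisting mA (tauTwo τAB τAC) := by
  intro x a a'
  induction x with
  | zero => simp
  | add x y hx hy => simp only [map_add, TensorProduct.add_tmul, hx, hy]
  | tmul b c =>
    rw [tauTwo_tmul, tauTwo_tmul, hAC]
    generalize τAC (c ⊗ₜ a) = x
    induction x with
    | zero => simp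
    | add x y hx hy => simp only [map_add, TensorProduct.tmul_add, TensorProduct.add_tmul, hx, hy]
    | tmul a₁ c₁ =>
      simp only [TensorProduct.assoc_tmul, TensorProduct.assoc_symm_tmul, LinearMap.lTensor_tmul,
        LinearMap.rTensor_tmul]
      have key (x : A ⊗[k] C) : TensorProduct.assoc k A B C (τAB.rTensor C
          ((TensorProduct.assoc k B A C).symm
            (b ⊗ₜ mA.rTensor C ((TensorProduct.assoc k A A C).symm (a₁ ⊗ₜ x)))))
          = TensorProduct.assoc k A B C (((mA.rTensor B).rTensor C)
            (((TensorProduct.assoc k A A B).symm.toLinearMap.rTensor C)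
            (((τAB.lTensor A).rTensor C)
            (((TensorProduct.assoc k A B A).toLinearMap.rTensor C)
            ((TensorProduct.assoc k (A ⊗[k] B) A C).symm (τAB (b ⊗ₜ a₁) ⊗ₜ x)))))) := by
        induction x with
        | zero => simp
        | add x y hx hy => simp only [map_add, TensorProduct.tmul_add, hx, hy]
        | tmul a₂ c₂ => simp [hAB b a₁ a₂]
      rw [key]
      generalize τAB (b ⊗ₜ a₁) = y
      induction y with
      | zero => simp
      | add x y hx hy => simp only [map_add, TensorProduct.add_tmul, hx, hy]
      | tmul a₂ b₁ =>
        simp only [TensorProduct.assoc_tmul, LinearMap.lTensor_tmul, tauTwo_tmul]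
        generalize τAC (c₁ ⊗ₜ a') = x
        induction x with
        | zero => simp
        | add x y hx hy => simp only [map_add, TensorProduct.tmul_add, hx, hy]
        | tmul a₃ c₃ =>
          simp only [TensorProduct.assoc_tmul, TensorProduct.assoc_symm_tmul,
            LinearMap.lTensor_tmul, LinearMap.rTensor_tmul, LinearEquiv.coe_coe]
          generalize τAB (b₁ ⊗ₜ a₃) = y
          induction y with
          | zero => simp
          | add x y hx hy =>
            simp only [map_add, TensorProduct.tmul_add, TensorProduct.add_tmul, hx, hy]
          | tmul a₄ b₂ => simp

lemma ttpMul_tmul_eq_left (τ : B ⊗[k] A →ₗ[k] A ⊗[k] B) (a a' : A) (b b' : B) :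
    ttpMul k mA mB τ ((a ⊗ₜ b) ⊗ₜ (a' ⊗ₜ b')) =
      mA.rTensor B ((TensorProduct.assoc k A A B).symm
        (a ⊗ₜ mB.lTensor A (TensorProduct.assoc k A B B (τ (b ⊗ₜ a') ⊗ₜ b')))) := by
  rw [ttpMul_tmul]
  generalize τ (b ⊗ₜ a') = x
  induction x with
  | zero => simp
  | add x y hx hy => simp only [map_add, TensorProduct.tmul_add, TensorProduct.add_tmul, hx, hy]
  | tmul a₁ b₁ => simp

lemma ttpMul_tmul_eq_right (τ : B ⊗[k] A →ₗ[k] A ⊗[k] B) (a a' : A) (b b' : B) :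
    ttpMul k mA mB τ ((a ⊗ₜ b) ⊗ₜ (a' ⊗ₜ b')) =
      mB.lTensor A (TensorProduct.assoc k A B B
        (mA.rTensor B ((TensorProduct.assoc k A A B).symm (a ⊗ₜ τ (b ⊗ₜ a'))) ⊗ₜ b')) := by
  rw [ttpMul_tmul]
  generalize τ (b ⊗ₜ a') = x
  induction x with
  | zero => simp
  | add x y hx hy => simp only [map_add, TensorProduct.tmul_add, TensorProduct.add_tmul, hx, hy]
  | tmul a₁ b₁ => simp

lemma IsRightTwisting.tauOne_mul_left (hAC : IsRightTwisting mA τAC) (c : C) (a : A)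
    (x : A ⊗[k] B) :
    _root_.tauOne τBC τAC
        (c ⊗ₜ mA.rTensor B ((TensorProduct.assoc k A A B).symm (a ⊗ₜ x))) =
      (mA.rTensor B).rTensor C ((TensorProduct.assoc k A A B).symm.toLinearMap.rTensor C
        ((TensorProduct.assoc k A (A ⊗[k] B) C).symm
          ((_root_.tauOne τBC τAC).lTensor A
            (TensorProduct.assoc k A C (A ⊗[k] B) (τAC (c ⊗ₜ a) ⊗ₜ x))))) := by
  induction x with
  | zero => simp
  | add x y hx hy => simp only [map_add, TensorProduct.tmul_add, hx, hy]
  | tmul a' b =>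
    rw [TensorProduct.assoc_symm_tmul, LinearMap.rTensor_tmul, tauOne_tmul, hAC]
    generalize τAC (c ⊗ₜ a) = z
    induction z with
    | zero => simp
    | add x y hx hy => simp only [map_add, TensorProduct.add_tmul, hx, hy]
    | tmul a₁ c₁ =>
      simp only [TensorProduct.assoc_tmul, LinearMap.lTensor_tmul, tauOne_tmul]
      generalize τAC (c₁ ⊗ₜ a') = z
      induction z with
      | zero => simp
      | add x y hx hy => simp only [map_add, TensorProduct.tmul_add, TensorProduct.add_tmul, hx, hy]
      | tmul a₂ c₂ =>
        simp only [TensorProduct.assoc_tmul, TensorProduct.assoc_symm_tmul,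
          LinearMap.lTensor_tmul, LinearMap.rTensor_tmul]
        generalize τBC (c₂ ⊗ₜ b) = z
        induction z with
        | zero => simp
        | add x y hx hy => simp only [map_add, TensorProduct.tmul_add, hx, hy]
        | tmul b₁ c₃ => simp

lemma IsRightTwisting.tauOne_mul_right (hBC : IsRightTwisting mB τBC) (c : C) (x : A ⊗[k] B)
    (b : B) :
    _root_.tauOne τBC τAC (c ⊗ₜ mB.lTensor A (TensorProduct.assoc k A B B (x ⊗ₜ b))) =
      (mB.lTensor A).rTensor C ((TensorProduct.assoc k A B B).toLinearMap.rTensor C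
        ((TensorProduct.assoc k (A ⊗[k] B) B C).symm (τBC.lTensor (A ⊗[k] B)
          (TensorProduct.assoc k (A ⊗[k] B) C B (_root_.tauOne τBC τAC (c ⊗ₜ x) ⊗ₜ b))))) := by
  induction x with
  | zero => simp
  | add x y hx hy => simp only [map_add, TensorProduct.tmul_add, TensorProduct.add_tmul, hx, hy]
  | tmul a b' =>
    rw [TensorProduct.assoc_tmul, LinearMap.lTensor_tmul, tauOne_tmul, tauOne_tmul]
    generalize τAC (c ⊗ₜ a) = z
    induction z with
    | zero => simp
    | add x y hx hy => simp only [map_add, TensorProduct.add_tmul, hx, hy]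
    | tmul a₁ c₁ =>
      rw [TensorProduct.assoc_tmul, LinearMap.lTensor_tmul, hBC, TensorProduct.assoc_tmul,
        LinearMap.lTensor_tmul]
      generalize τBC (c₁ ⊗ₜ b') = z
      induction z with
      | zero => simp
      | add x y hx hy => simp only [map_add, TensorProduct.tmul_add, TensorProduct.add_tmul, hx, hy]
      | tmul b₁ c₂ =>
        simp only [TensorProduct.assoc_tmul, TensorProduct.assoc_symm_tmul,
          LinearMap.lTensor_tmul]
        generalize τBC (c₂ ⊗ₜ b) = z
        induction z with
        | zero => simp
        | add x y hx hy => simp only [map_add, TensorProduct.tmul_add, hx, hy]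
        | tmul b₂ c₃ => simp

lemma IsLeftTwisting.tauTwo_mul_right (hAC : IsLeftTwisting mC τAC) (y : B ⊗[k] C) (c : C)
    (a : A) :
    _root_.tauTwo τAB τAC (mC.lTensor B (TensorProduct.assoc k B C C (y ⊗ₜ c)) ⊗ₜ a) =
      (mC.lTensor B).lTensor A ((TensorProduct.assoc k B C C).toLinearMap.lTensor A
        (TensorProduct.assoc k A (B ⊗[k] C) C ((_root_.tauTwo τAB τAC).rTensor C
          ((TensorProduct.assoc k (B ⊗[k] C) A C).symm (y ⊗ₜ τAC (c ⊗ₜ a)))))) := by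
  induction y with
  | zero => simp
  | add x y hx hy => simp only [map_add, TensorProduct.add_tmul, hx, hy]
  | tmul b c' =>
    rw [TensorProduct.assoc_tmul, LinearMap.lTensor_tmul, tauTwo_tmul, hAC]
    generalize τAC (c ⊗ₜ a) = z
    induction z with
    | zero => simp
    | add x y hx hy => simp only [map_add, TensorProduct.tmul_add, hx, hy]
    | tmul a₁ c₁ =>
      simp only [TensorProduct.assoc_symm_tmul, LinearMap.rTensor_tmul, tauTwo_tmul]
      generalize τAC (c' ⊗ₜ a₁) = z
      induction z with
      | zero => simp
      | add x y hx hy => simp only [map_add, TensorProduct.tmul_add, TensorProduct.add_tmul, hx, hy]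
      | tmul a₂ c₂ =>
        simp only [TensorProduct.assoc_tmul, TensorProduct.assoc_symm_tmul,
          LinearMap.lTensor_tmul, LinearMap.rTensor_tmul]
        generalize τAB (b ⊗ₜ a₂) = z
        induction z with
        | zero => simp
        | add x y hx hy => simp only [map_add, TensorProduct.add_tmul, hx, hy]
        | tmul a₃ b₁ => simp

lemma IsLeftTwisting.tauTwo_mul_left (hAB : IsLeftTwisting mB τAB) (b : B) (y : B ⊗[k] C)
    (a : A) :
    _root_.tauTwo τAB τAC
        (mB.rTensor C ((TensorProduct.assoc k B B C).symm (b ⊗ₜ y)) ⊗ₜ a) =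
      (mB.rTensor C).lTensor A ((TensorProduct.assoc k B B C).symm.toLinearMap.lTensor A
        (TensorProduct.assoc k A B (B ⊗[k] C) (τAB.rTensor (B ⊗[k] C)
          ((TensorProduct.assoc k B A (B ⊗[k] C)).symm
            (b ⊗ₜ _root_.tauTwo τAB τAC (y ⊗ₜ a)))))) := by
  induction y with
  | zero => simp
  | add x y hx hy => simp only [map_add, TensorProduct.tmul_add, TensorProduct.add_tmul, hx, hy]
  | tmul b' c =>
    rw [TensorProduct.assoc_symm_tmul, LinearMap.rTensor_tmul, tauTwo_tmul, tauTwo_tmul]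
    generalize τAC (c ⊗ₜ a) = z
    induction z with
    | zero => simp
    | add x y hx hy => simp only [map_add, TensorProduct.tmul_add, hx, hy]
    | tmul a₁ c₁ =>
      rw [TensorProduct.assoc_symm_tmul, LinearMap.rTensor_tmul, hAB,
        TensorProduct.assoc_symm_tmul, LinearMap.rTensor_tmul]
      generalize τAB (b' ⊗ₜ a₁) = z
      induction z with
      | zero => simp
      | add x y hx hy => simp only [map_add, TensorProduct.tmul_add, TensorProduct.add_tmul, hx, hy]
      | tmul a₂ b₁ =>
        simp only [TensorProduct.assoc_tmul, TensorProduct.assoc_symm_tmul,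
          LinearMap.rTensor_tmul]
        generalize τAB (b ⊗ₜ a₂) = z
        induction z with
        | zero => simp
        | add x y hx hy => simp only [map_add, TensorProduct.add_tmul, hx, hy]
        | tmul a₃ b₂ => simp

/-- The hexagon (Yang-Baxter) identity on `C ⊗ B ⊗ A` relating three twisting maps. -/
def TwistHexagon (τAB : B ⊗[k] A →ₗ[k] A ⊗[k] B) (τBC : C ⊗[k] B →ₗ[k] B ⊗[k] C)
    (τAC : C ⊗[k] A →ₗ[k] A ⊗[k] C) : Prop :=
  ∀ (c : C) (b : B) (a : A), TensorProduct.assoc k A B C (tauOne τBC τAC (c ⊗ₜ τAB (b ⊗ₜ a))) =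
    tauTwo τAB τAC (τBC (c ⊗ₜ b) ⊗ₜ a)

lemma TwistHexagon.isRightTwisting_tauOne (h : TwistHexagon τAB τBC τAC)
    (hBC : IsRightTwisting mB τBC) (hAC : IsRightTwisting mA τAC) :
    IsRightTwisting (ttpMul k mA mB τAB) (tauOne τBC τAC) := by
  intro c x y
  induction x with
  | zero => simp
  | add x y hx hy => simp only [map_add, TensorProduct.tmul_add, TensorProduct.add_tmul, hx, hy]
  | tmul a b =>
  induction y with
  | zero => simp
  | add x y hx hy => simp only [map_add, TensorProduct.tmul_add, hx, hy]
  | tmul a' b' =>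
    rw [ttpMul_tmul_eq_left, hAC.tauOne_mul_left, tauOne_tmul]
    generalize τAC (c ⊗ₜ a) = z
    induction z with
    | zero => simp
    | add x y hx hy => simp only [map_add, TensorProduct.add_tmul, hx, hy]
    | tmul a₁ c₁ =>
      simp only [TensorProduct.assoc_tmul, LinearMap.lTensor_tmul, hBC.tauOne_mul_right]
      rw [(LinearEquiv.eq_symm_apply _).2 (h c₁ b a')]
      generalize τBC (c₁ ⊗ₜ b) = z
      induction z with
      | zero => simp
      | add x y hx hy => simp only [map_add, TensorProduct.tmul_add, TensorProduct.add_tmul, hx, hy]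
      | tmul b₁ c₂ =>
        simp only [TensorProduct.assoc_tmul, TensorProduct.assoc_symm_tmul,
          LinearMap.lTensor_tmul, tauOne_tmul, tauTwo_tmul, LinearEquiv.symm_apply_apply]
        generalize τAC (c₂ ⊗ₜ a') = z
        induction z with
        | zero => simp
        | add x y hx hy =>
          simp only [map_add, TensorProduct.tmul_add, TensorProduct.add_tmul, hx, hy]
        | tmul a₂ c₃ =>
          simp only [TensorProduct.assoc_tmul, TensorProduct.assoc_symm_tmul,
            LinearMap.lTensor_tmul, LinearMap.rTensor_tmul]
          generalize τBC (c₃ ⊗ₜ b') = z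
          induction z with
          | zero => simp
          | add x y hx hy =>
            simp only [map_add, TensorProduct.tmul_add, hx, hy]
          | tmul b₂ c₄ => simp [ttpMul_tmul_eq_left]

lemma TwistHexagon.isLeftTwisting_tauTwo (h : TwistHexagon τAB τBC τAC)
    (hAB : IsLeftTwisting mB τAB) (hAC : IsLeftTwisting mC τAC) :
    IsLeftTwisting (ttpMul k mB mC τBC) (tauTwo τAB τAC) := by
  intro x y a
  induction y with
  | zero => simp
  | add x y hx hy => simp only [map_add, TensorProduct.tmul_add, TensorProduct.add_tmul, hx, hy]
  | tmul b' c' =>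
  induction x with
  | zero => simp
  | add x y hx hy => simp only [map_add, TensorProduct.add_tmul, hx, hy]
  | tmul b c =>
    rw [ttpMul_tmul_eq_right, hAC.tauTwo_mul_right, tauTwo_tmul]
    generalize τAC (c' ⊗ₜ a) = z
    induction z with
    | zero => simp
    | add x y hx hy => simp only [map_add, TensorProduct.tmul_add, hx, hy]
    | tmul a₁ c₁ =>
      simp only [TensorProduct.assoc_symm_tmul, LinearMap.rTensor_tmul, hAB.tauTwo_mul_left]
      rw [← h c b' a₁]
      generalize τAB (b' ⊗ₜ a₁) = z
      induction z with
      | zero => simp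
      | add x y hx hy => simp only [map_add, TensorProduct.tmul_add, TensorProduct.add_tmul, hx, hy]
      | tmul a₂ b₁ =>
        simp only [TensorProduct.assoc_tmul, TensorProduct.assoc_symm_tmul,
          LinearMap.rTensor_tmul, tauOne_tmul, tauTwo_tmul, LinearEquiv.apply_symm_apply]
        generalize τAC (c ⊗ₜ a₂) = z
        induction z with
        | zero => simp
        | add x y hx hy =>
          simp only [map_add, TensorProduct.tmul_add, TensorProduct.add_tmul, hx, hy]
        | tmul a₃ c₂ =>
          simp only [TensorProduct.assoc_tmul, TensorProduct.assoc_symm_tmul,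
            LinearMap.lTensor_tmul, LinearMap.rTensor_tmul]
          generalize τAB (b ⊗ₜ a₃) = z
          induction z with
          | zero => simp
          | add x y hx hy =>
            simp only [map_add, TensorProduct.add_tmul, hx, hy]
          | tmul a₄ b₂ => simp [ttpMul_tmul_eq_right]

lemma assoc_ttpMul_tauOne (x y : (A ⊗[k] B) ⊗[k] C) :
    TensorProduct.assoc k A B C
        (ttpMul k (ttpMul k mA mB τAB) mC (tauOne τBC τAC) (x ⊗ₜ y)) =
      ttpMul k mA (ttpMul k mB mC τBC) (tauTwo τAB τAC)
        (TensorProduct.assoc k A B C x ⊗ₜ TensorProduct.assoc k A B C y) := by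
  refine LinearMap.congr_fun (f := (TensorProduct.assoc k A B C).toLinearMap ∘ₗ
    ttpMul k (ttpMul k mA mB τAB) mC (tauOne τBC τAC)) (g := ttpMul k mA (ttpMul k mB mC τBC)
      (tauTwo τAB τAC) ∘ₗ TensorProduct.map (TensorProduct.assoc k A B C).toLinearMap
        (TensorProduct.assoc k A B C).toLinearMap) ?_ (x ⊗ₜ y)
  ext a b c a' b' c'
  simp only [TensorProduct.AlgebraTensorModule.curry_apply, TensorProduct.curry_apply,
    LinearMap.coe_restrictScalars, LinearMap.comp_apply, LinearEquiv.coe_coe,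
    TensorProduct.map_tmul, TensorProduct.assoc_tmul, ttpMul_tmul, tauOne_tmul, tauTwo_tmul]
  generalize τAC (c ⊗ₜ a') = z
  induction z with
  | zero => simp
  | add x y hx hy => simp only [map_add, TensorProduct.tmul_add, TensorProduct.add_tmul, hx, hy]
  | tmul a₁ c₁ =>
    simp only [TensorProduct.assoc_tmul, TensorProduct.assoc_symm_tmul,
      LinearMap.lTensor_tmul, LinearMap.rTensor_tmul]
    have key (x : A ⊗[k] B) :
        TensorProduct.map mA (ttpMul k mB mC τBC)
          ((TensorProduct.assoc k A A ((B ⊗[k] C) ⊗[k] (B ⊗[k] C))).symm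
            (a ⊗ₜ TensorProduct.assoc k A (B ⊗[k] C) (B ⊗[k] C)
              (TensorProduct.assoc k A B C (x ⊗ₜ c₁) ⊗ₜ (b' ⊗ₜ c')))) =
        mA.rTensor (B ⊗[k] C) ((TensorProduct.assoc k A A (B ⊗[k] C)).symm
          (a ⊗ₜ (TensorProduct.map mB mC).lTensor A
            ((TensorProduct.assoc k B B (C ⊗[k] C)).symm.toLinearMap.lTensor A
              (TensorProduct.assoc k A B (B ⊗[k] (C ⊗[k] C))
                (x ⊗ₜ TensorProduct.assoc k B C C (τBC (c₁ ⊗ₜ b') ⊗ₜ c')))))) := by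
      induction x with
      | zero => simp
      | add x y hx hy => simp only [map_add, TensorProduct.tmul_add, TensorProduct.add_tmul, hx, hy]
      | tmul a₂ b₂ => simp [ttpMul_tmul]
    rw [key]
    generalize τBC (c₁ ⊗ₜ b') = z
    induction z with
    | zero => simp
    | add x y hx hy => simp only [map_add, TensorProduct.tmul_add, TensorProduct.add_tmul, hx, hy]
    | tmul b₁ c₂ =>
      simp only [TensorProduct.assoc_tmul, TensorProduct.assoc_symm_tmul,
        TensorProduct.map_tmul, ttpMul_tmul]
      generalize τAB (b ⊗ₜ a₁) = z
      induction z with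
      | zero => simp
      | add x y hx hy => simp only [map_add, TensorProduct.tmul_add, TensorProduct.add_tmul, hx, hy]
      | tmul a₂ b₂ => simp

variable {uA : A} {uB : B} {uC : C}

lemma ttpMul_unit_tmul_tmul_unit (hA : ∀ a, mA (uA ⊗ₜ a) = a)
    (hB : ∀ b, mB (b ⊗ₜ uB) = b) (b : B) (a : A) :
    ttpMul k mA mB τAB ((uA ⊗ₜ b) ⊗ₜ (a ⊗ₜ uB)) =
      τAB (b ⊗ₜ a) := by
  rw [ttpMul_tmul]
  generalize τAB (b ⊗ₜ a) = z
  induction z with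
  | zero => simp
  | add x y hx hy => simp only [map_add, TensorProduct.tmul_add, TensorProduct.add_tmul, hx, hy]
  | tmul a₁ b₁ => simp [hA, hB]

lemma tauOne_tmul_unit_tmul (hAC : ∀ c : C, τAC (c ⊗ₜ uA) = uA ⊗ₜ c) (c : C) (b : B) :
    tauOne τBC τAC (c ⊗ₜ (uA ⊗ₜ b)) =
      (TensorProduct.assoc k A B C).symm (uA ⊗ₜ τBC (c ⊗ₜ b)) := by
  simp [tauOne_tmul, hAC]

lemma tauOne_tmul_tmul_unit (hBC : ∀ c : C, τBC (c ⊗ₜ uB) = uB ⊗ₜ c) (c : C) (a : A) :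
    tauOne τBC τAC (c ⊗ₜ (a ⊗ₜ uB)) =
      ((TensorProduct.mk k A B).flip uB).rTensor C (τAC (c ⊗ₜ a)) := by
  rw [tauOne_tmul]
  generalize τAC (c ⊗ₜ a) = z
  induction z with
  | zero => simp
  | add x y hx hy => simp only [map_add, TensorProduct.add_tmul, hx, hy]
  | tmul a₁ c₁ => simp [hBC]

lemma tauTwo_unit_tmul_tmul (hAB : ∀ a : A, τAB (uB ⊗ₜ a) = a ⊗ₜ uB) (c : C) (a : A) :
    tauTwo τAB τAC ((uB ⊗ₜ c) ⊗ₜ a) =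
      (TensorProduct.mk k B C uB).lTensor A (τAC (c ⊗ₜ a)) := by
  rw [tauTwo_tmul]
  generalize τAC (c ⊗ₜ a) = z
  induction z with
  | zero => simp
  | add x y hx hy => simp only [map_add, TensorProduct.tmul_add, hx, hy]
  | tmul a₁ c₁ => simp [hAB]

lemma tauTwo_tmul_unit_tmul (hAC : ∀ a : A, τAC (uC ⊗ₜ a) = a ⊗ₜ uC) (b : B) (a : A) :
    tauTwo τAB τAC ((b ⊗ₜ uC) ⊗ₜ a) =
      TensorProduct.assoc k A B C (τAB (b ⊗ₜ a) ⊗ₜ uC) := by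
  simp [tauTwo_tmul, hAC]

lemma IsRightTwisting.twistHexagon (hA : ∀ a, mA (uA ⊗ₜ a) = a) (hB : ∀ b, mB (b ⊗ₜ uB) = b)
    (hBC : ∀ c : C, τBC (c ⊗ₜ uB) = uB ⊗ₜ c)
    (hAC : ∀ c : C, τAC (c ⊗ₜ uA) = uA ⊗ₜ c)
    (h : IsRightTwisting (ttpMul k mA mB τAB)
      (tauOne τBC τAC)) :
    TwistHexagon τAB τBC τAC := by
  intro c b a
  rw [← ttpMul_unit_tmul_tmul_unit hA hB b a, h, tauOne_tmul_unit_tmul hAC]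
  generalize τBC (c ⊗ₜ b) = z
  induction z with
  | zero => simp only [map_zero, TensorProduct.tmul_zero, TensorProduct.zero_tmul]
  | add x y hx hy => simp only [map_add, TensorProduct.tmul_add, TensorProduct.add_tmul, hx, hy]
  | tmul b₁ c₁ =>
    rw [TensorProduct.assoc_symm_tmul, TensorProduct.assoc_tmul, LinearMap.lTensor_tmul,
      tauOne_tmul_tmul_unit hBC, tauTwo_tmul]
    generalize τAC (c₁ ⊗ₜ a) = z
    induction z with
    | zero => simp only [map_zero, TensorProduct.tmul_zero]
    | add x y hx hy => simp only [map_add, TensorProduct.tmul_add, hx, hy]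
    | tmul a₁ c₂ =>
      rw [LinearMap.rTensor_tmul, LinearMap.flip_apply, TensorProduct.mk_apply,
        TensorProduct.assoc_symm_tmul, LinearMap.rTensor_tmul, ttpMul_unit_tmul_tmul_unit hA hB,
        TensorProduct.assoc_symm_tmul, LinearMap.rTensor_tmul]

lemma IsLeftTwisting.twistHexagon (hB : ∀ b, mB (uB ⊗ₜ b) = b) (hC : ∀ c, mC (c ⊗ₜ uC) = c)
    (hAB : ∀ a : A, τAB (uB ⊗ₜ a) = a ⊗ₜ uB)
    (hAC : ∀ a : A, τAC (uC ⊗ₜ a) = a ⊗ₜ uC)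
    (h : IsLeftTwisting (ttpMul k mB mC τBC)
      (tauTwo τAB τAC)) :
    TwistHexagon τAB τBC τAC := by
  intro c b a
  rw [← ttpMul_unit_tmul_tmul_unit hB hC c b, h, tauTwo_tmul_unit_tmul hAC]
  generalize τAB (b ⊗ₜ a) = z
  induction z with
  | zero => simp only [map_zero, TensorProduct.tmul_zero, TensorProduct.zero_tmul]
  | add x y hx hy => simp only [map_add, TensorProduct.tmul_add, TensorProduct.add_tmul, hx, hy]
  | tmul a₁ b₁ =>
    rw [TensorProduct.assoc_tmul, TensorProduct.assoc_symm_tmul, LinearMap.rTensor_tmul,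
      tauTwo_unit_tmul_tmul hAB, tauOne_tmul]
    generalize τAC (c ⊗ₜ a₁) = z
    induction z with
    | zero => simp only [map_zero, TensorProduct.zero_tmul]
    | add x y hx hy => simp only [map_add, TensorProduct.add_tmul, hx, hy]
    | tmul a₂ c₁ =>
      rw [LinearMap.lTensor_tmul, TensorProduct.mk_apply, TensorProduct.assoc_tmul,
        TensorProduct.assoc_tmul, LinearMap.lTensor_tmul, LinearMap.lTensor_tmul,
        ttpMul_unit_tmul_tmul_unit hB hC, LinearEquiv.apply_symm_apply]

end ThreeTwists

section Algebras

variable {k A B C : Type*} [Field k] [Ring A] [Algebra k A] [Ring B] [Algebra k B]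
  [Ring C] [Algebra k C]
  {τAB : B ⊗[k] A →ₗ[k] A ⊗[k] B} {τBC : C ⊗[k] B →ₗ[k] B ⊗[k] C} {τAC : C ⊗[k] A →ₗ[k] A ⊗[k] C}

lemma isTwistingMapGen_tauOne_iff (hBC : IsTwistingMap k τBC)
    (hAC : IsTwistingMap k τAC) :
    IsTwistingMapGen k ((1 : A) ⊗ₜ[k] (1 : B))
        (ttpMul k (LinearMap.mul' k A) (LinearMap.mul' k B) τAB)
        (1 : C) (LinearMap.mul' k C) (tauOne τBC τAC) ↔ TwistHexagon τAB τBC τAC := by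
  refine ⟨fun h => (h.isRightTwisting (by simp)).twistHexagon
    (by simp) (by simp) hBC.2.1 hAC.2.1, fun h =>
    ⟨tauOne_bijective hBC.1 hAC.1, fun c => ?_, fun x => ?_,
      ((hBC.isLeftTwisting (by simp)).tauOne (hAC.isLeftTwisting (by simp))).comp_map_eq
        (h.isRightTwisting_tauOne (hBC.isRightTwisting (by simp))
          (hAC.isRightTwisting (by simp)))⟩⟩
  · simp [tauOne_tmul_unit_tmul hAC.2.1, hBC.2.1]
  · induction x with
    | zero => simp
    | add x y hx hy => simp only [map_add, TensorProduct.tmul_add, TensorProduct.add_tmul, hx, hy]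
    | tmul a b => simp [tauOne_tmul, hAC.2.2.1, hBC.2.2.1]

lemma isTwistingMapGen_tauTwo_iff (hAB : IsTwistingMap k τAB)
    (hAC : IsTwistingMap k τAC) :
    IsTwistingMapGen k (1 : A) (LinearMap.mul' k A) ((1 : B) ⊗ₜ[k] (1 : C))
        (ttpMul k (LinearMap.mul' k B) (LinearMap.mul' k C) τBC) (tauTwo τAB τAC) ↔
      TwistHexagon τAB τBC τAC := by
  refine ⟨fun h => (h.isLeftTwisting (by simp)).twistHexagon
    (by simp) (by simp) hAB.2.2.1 hAC.2.2.1, fun h =>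
    ⟨tauTwo_bijective hAB.1 hAC.1, fun x => ?_, fun a => ?_,
      (h.isLeftTwisting_tauTwo (hAB.isLeftTwisting (by simp))
        (hAC.isLeftTwisting (by simp))).comp_map_eq
        ((hAB.isRightTwisting (by simp)).tauTwo (hAC.isRightTwisting (by simp)))⟩⟩
  · induction x with
    | zero => simp
    | add x y hx hy => simp only [map_add, TensorProduct.tmul_add, TensorProduct.add_tmul, hx, hy]
    | tmul b c => simp [tauTwo_tmul, hAC.2.1, hAB.2.1]
  · simp [tauTwo_tmul_unit_tmul hAC.2.2.1, hAB.2.2.1]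

end Algebras

theorem twisted_tensor_product_associativity
    {k A B C : Type*} [Field k]
    [Ring A] [Algebra k A] [Ring B] [Algebra k B] [Ring C] [Algebra k C]
    (τAB : B ⊗[k] A →ₗ[k] A ⊗[k] B) (τBC : C ⊗[k] B →ₗ[k] B ⊗[k] C)
    (τAC : C ⊗[k] A →ₗ[k] A ⊗[k] C)
    (hAB : IsTwistingMap k τAB) (hBC : IsTwistingMap k τBC) (hAC : IsTwistingMap k τAC) :
    -- `τ₁` is a twisting map between `A ⊗_{τ_AB} B` and `C` iff `τ₂` is one between
    -- `A` and `B ⊗_{τ_BC} C`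
    (IsTwistingMapGen k ((1 : A) ⊗ₜ[k] (1 : B))
        (ttpMul k (LinearMap.mul' k A) (LinearMap.mul' k B) τAB)
        (1 : C) (LinearMap.mul' k C) (tauOne τBC τAC)
      ↔ IsTwistingMapGen k (1 : A) (LinearMap.mul' k A)
        ((1 : B) ⊗ₜ[k] (1 : C))
        (ttpMul k (LinearMap.mul' k B) (LinearMap.mul' k C) τBC) (tauTwo τAB τAC)) ∧
    -- and in that case the associator is an isomorphism of algebras
    (IsTwistingMapGen k ((1 : A) ⊗ₜ[k] (1 : B))
        (ttpMul k (LinearMap.mul' k A) (LinearMap.mul' k B) τAB)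
        (1 : C) (LinearMap.mul' k C) (tauOne τBC τAC) →
      (TensorProduct.assoc k A B C) (((1 : A) ⊗ₜ[k] (1 : B)) ⊗ₜ[k] (1 : C))
          = (1 : A) ⊗ₜ[k] ((1 : B) ⊗ₜ[k] (1 : C)) ∧
      ∀ x y : (A ⊗[k] B) ⊗[k] C,
        (TensorProduct.assoc k A B C)
          (ttpMul k (ttpMul k (LinearMap.mul' k A) (LinearMap.mul' k B) τAB)
            (LinearMap.mul' k C) (tauOne τBC τAC) (x ⊗ₜ[k] y))
        = ttpMul k (LinearMap.mul' k A)
            (ttpMul k (LinearMap.mul' k B) (LinearMap.mul' k C) τBC) (tauTwo τAB τAC)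
            (((TensorProduct.assoc k A B C) x) ⊗ₜ[k] ((TensorProduct.assoc k A B C) y))) := by
  exact ⟨(isTwistingMapGen_tauOne_iff hBC hAC).trans
      (isTwistingMapGen_tauTwo_iff hAB hAC).symm,
    fun _ => ⟨TensorProduct.assoc_tmul _ _ _, assoc_ttpMul_tauOne⟩⟩
end

section
/- Let A = ⊕_{i∈ℤ} A_i and B = ⊕_{i∈ℤ} B_i be ℤ-graded k-algebras and let τ : B ⊗ A → A ⊗ B be a strongly graded twisting map. Endow the twisted tensor product S = A ⊗_τ B with the bigrading S_{(i,j)} := A_{i+j} ⊗ B_j for i, j ∈ ℤ. Then S is a ℤ×ℤ-bigraded algebra: 1 ⊗ 1 ∈ S_{(0,0)} and the twisted multiplication satisfies ∇_τ(S_{(i,j)} ⊗ S_{(k,l)}) ⊆ S_{(i+k, j+l)} for all i, j, k, l ∈ ℤ. Moreover the degree-(0,·) part S_0 := ⊕_{j∈ℤ} S_{(0,j)} coincides, as a ℤ-graded algebra, with the twisted Segre product A ∘_τ B = ⊕_{j∈ℤ} (A_j ⊗ B_j). -/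
open TensorProduct

/-- The image `p ⊗ q` of a pair of submodules inside `A ⊗ B`. -/
noncomputable def subTensor {k A B : Type*} [Field k] [AddCommGroup A] [Module k A]
    [AddCommGroup B] [Module k B] (p : Submodule k A) (q : Submodule k B) :
    Submodule k (A ⊗[k] B) :=
  LinearMap.range (TensorProduct.mapIncl p q)

/-!
Statement 13: For `ℤ`-graded algebras `A`, `B` and a strongly graded twisting map `τ`,
the twisted tensor product `S = A ⊗_τ B` with bigrading `S_{(i,j)} = A_{i+j} ⊗ B_j` is a
`ℤ×ℤ`-bigraded algebra, and its degree-`(0,·)` part is the twisted Segre product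
`A ∘_τ B = ⊕ⱼ (Aⱼ ⊗ Bⱼ)` as a `ℤ`-graded algebra.
-/

theorem tmul_mem_subTensor {k A B : Type*} [Field k] [AddCommGroup A] [Module k A]
    [AddCommGroup B] [Module k B] {p : Submodule k A} {q : Submodule k B} {a : A} {b : B}
    (ha : a ∈ p) (hb : b ∈ q) : a ⊗ₜ[k] b ∈ subTensor p q :=
  ⟨(⟨a, ha⟩ : p) ⊗ₜ[k] (⟨b, hb⟩ : q), rfl⟩

/-- A submodule containing the pure tensors of elements of `p` and `q` contains `p ⊗ q`. -/
theorem subTensor_le {k A B : Type*} [Field k] [AddCommGroup A] [Module k A]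
    [AddCommGroup B] [Module k B] {p : Submodule k A} {q : Submodule k B}
    {N : Submodule k (A ⊗[k] B)} (h : ∀ a ∈ p, ∀ b ∈ q, a ⊗ₜ[k] b ∈ N) :
    subTensor p q ≤ N := by
  rintro _ ⟨x, rfl⟩
  induction x with
  | zero => simp
  | tmul a b => exact h a a.2 b b.2
  | add x y hx hy => rw [map_add]; exact N.add_mem hx hy

theorem ttpMul_tmul_tmul {k A B : Type*} [Field k] [Ring A] [Algebra k A] [Ring B] [Algebra k B]
    (τ : B ⊗[k] A →ₗ[k] A ⊗[k] B) (a a' : A) (b b' : B) :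
    ttpMul k (LinearMap.mul' k A) (LinearMap.mul' k B) τ ((a ⊗ₜ[k] b) ⊗ₜ[k] (a' ⊗ₜ[k] b'))
      = TensorProduct.map (LinearMap.mulLeft k a) (LinearMap.mulRight k b')
          (τ (b ⊗ₜ[k] a')) := by
  simp only [ttpMul, middleTwist, LinearMap.comp_apply, LinearEquiv.coe_coe,
    TensorProduct.assoc_tmul, TensorProduct.map_tmul, TensorProduct.assoc_symm_tmul,
    LinearMap.id_apply]
  induction τ (b ⊗ₜ[k] a') with
  | zero => simp
  | tmul x y => simp
  | add x y hx hy => simp only [TensorProduct.add_tmul, TensorProduct.tmul_add, map_add, hx, hy]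

theorem twisted_tensor_product_bigraded
    {k A B : Type*} [Field k]
    [Ring A] [Algebra k A] [Ring B] [Algebra k B]
    (𝒜 : ℤ → Submodule k A) (ℬ : ℤ → Submodule k B)
    [DirectSum.Decomposition 𝒜] [DirectSum.Decomposition ℬ]
    (hA1 : (1 : A) ∈ 𝒜 0) (hB1 : (1 : B) ∈ ℬ 0)
    (hAmul : ∀ (i j : ℤ) (a a' : A), a ∈ 𝒜 i → a' ∈ 𝒜 j → a * a' ∈ 𝒜 (i + j))
    (hBmul : ∀ (i j : ℤ) (b b' : B), b ∈ ℬ i → b' ∈ ℬ j → b * b' ∈ ℬ (i + j))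
    (τ : B ⊗[k] A →ₗ[k] A ⊗[k] B) (hτ : IsTwistingMap k τ)
    (hsg : ∀ (i j : ℤ) (b : B) (a : A), b ∈ ℬ j → a ∈ 𝒜 i →
      τ (b ⊗ₜ[k] a) ∈ subTensor (𝒜 i) (ℬ j)) :
    -- the unit lies in `S_{(0,0)}`
    ((1 : A) ⊗ₜ[k] (1 : B) ∈ subTensor (𝒜 (0 + 0)) (ℬ 0)) ∧
    -- `∇_τ(S_{(i,j)} ⊗ S_{(p,q)}) ⊆ S_{(i+p, j+q)}` where `S_{(i,j)} = A_{i+j} ⊗ B_j`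
    (∀ (i j p q : ℤ) (u v : A ⊗[k] B),
      u ∈ subTensor (𝒜 (i + j)) (ℬ j) → v ∈ subTensor (𝒜 (p + q)) (ℬ q) →
      ttpMul k (LinearMap.mul' k A) (LinearMap.mul' k B) τ (u ⊗ₜ[k] v)
        ∈ subTensor (𝒜 ((i + p) + (j + q))) (ℬ (j + q))) ∧
    -- the `j`-th graded piece of `S₀ = ⊕ⱼ S_{(0,j)}` is the `j`-th piece `Aⱼ ⊗ Bⱼ` of
    -- the twisted Segre product `A ∘_τ B`
    (∀ j : ℤ, subTensor (𝒜 (0 + j)) (ℬ j) = subTensor (𝒜 j) (ℬ j)) := by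
  refine ⟨tmul_mem_subTensor (by simpa using hA1) hB1, fun i j p q u v hu hv => ?_,
    fun j => by rw [zero_add]⟩
  set m := ttpMul k (LinearMap.mul' k A) (LinearMap.mul' k B) τ
  set T := subTensor (𝒜 ((i + p) + (j + q))) (ℬ (j + q))
  have hpure : ∀ a ∈ 𝒜 (i + j), ∀ b ∈ ℬ j, ∀ a' ∈ 𝒜 (p + q), ∀ b' ∈ ℬ q,
      m ((a ⊗ₜ[k] b) ⊗ₜ[k] (a' ⊗ₜ[k] b')) ∈ T := by
    intro a ha b hb a' ha' b' hb'
    rw [ttpMul_tmul_tmul]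
    refine subTensor_le (N := T.comap (TensorProduct.map (LinearMap.mulLeft k a)
      (LinearMap.mulRight k b'))) (fun x hx y hy => ?_) (hsg _ _ _ _ hb ha')
    refine tmul_mem_subTensor ?_ (hBmul _ _ _ _ hy hb')
    rw [add_add_add_comm]
    exact hAmul _ _ _ _ ha hx
  refine subTensor_le (N := T.comap (m ∘ₗ (TensorProduct.mk k _ _).flip v))
    (fun a ha b hb => ?_) hu
  exact subTensor_le (N := T.comap (m ∘ₗ TensorProduct.mk k _ _ (a ⊗ₜ[k] b)))
    (fun a' ha' b' hb' => hpure a ha b hb a' ha' b' hb') hv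
end
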